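/- In the tree setting with nesting (i), branching (ii) and goodness (iii), for every node u at level k with 1 ≤ k ≤ 2ℓ−1, one has |B_u| ≤ 4^{2ℓ−k} · 250√n(log₂ n) · |P_u|^{1 + 1/(2ℓ−k+1)}. -/

import Mathlib

open scoped Classical
open Finset

/-- Hamming weight. -/
def hwt {n : ℕ} (x : Fin n → Bool) : ℕ := (univ.filter fun i => x i = true).card

/-- `x` lies in the middle layers: `n/2 - √n ≤ |x| ≤ n/2 + √n` (with `s = √n`). -/
def MiddleLayers (n s : ℕ) (x : Fin n → Bool) : Prop :=
  n ≤ 2 * hwt x + 2 * s ∧ 2 * hwt x ≤ n + 2 * s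

/-- `A_{u,b}`: the coordinates on which all points of `S` equal `b`. -/
def Aset {n : ℕ} (S : Finset (Fin n → Bool)) (b : Bool) : Finset (Fin n) :=
  univ.filter fun i => ∀ x ∈ S, x i = b

/-- Nodes of the complete `N`-ary tree of depth `2ℓ` are encoded as lists over
`Fin N` of length at most `2ℓ` (the list of child indices from the node up to the
root, most recent first; the root is `[]` and the children of `u` are `a :: u`).
`Bset ℓ P u` is the union, over the leaves `w ++ u` of the subtree rooted at `u`,
of the dangerous sets `D_{w++u} = {i : ∃ x y ∈ P_{w++u}, x i ≠ y i}`. -/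
noncomputable def Bset (ℓ : ℕ) {n N : ℕ} (P : List (Fin N) → Finset (Fin n → Bool))
    (u : List (Fin N)) : Finset (Fin n) :=
  univ.filter fun i => ∃ w : List (Fin N), w.length + u.length = 2 * ℓ ∧
    ∃ x ∈ P (w ++ u), ∃ y ∈ P (w ++ u), x i ≠ y i

theorem Aset_anti {n : ℕ} {S T : Finset (Fin n → Bool)} (h : S ⊆ T) (b : Bool) :
    Aset T b ⊆ Aset S b := by
  intro i hi
  simp only [Aset, mem_filter, mem_univ, true_and] at hi ⊢
  exact fun x hx => hi x (h hx)

theorem Aset_disjoint {n : ℕ} {S : Finset (Fin n → Bool)} (hS : S.Nonempty) (b : Bool) :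
    Disjoint (Aset S b) (Aset S (!b)) := by
  obtain ⟨x, hx⟩ := hS
  rw [Finset.disjoint_left]
  intro i hi hi'
  simp only [Aset, mem_filter, mem_univ, true_and] at hi hi'
  have h1 := hi x hx
  have h2 := hi' x hx
  cases b <;> simp_all

theorem card_filter_false {n : ℕ} (x : Fin n → Bool) :
    (univ.filter fun i => x i = false).card + hwt x = n := by
  have h := Finset.card_filter_add_card_filter_not (s := (univ : Finset (Fin n)))
    (fun i => x i = false)
  simpa [hwt] using h

section Tree

variable {ℓ n N : ℕ} {P : List (Fin N) → Finset (Fin n → Bool)}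

theorem nested_append
    (hnest : ∀ u : List (Fin N), 1 ≤ u.length → u.length ≤ 2 * ℓ - 1 →
      ∀ a : Fin N, P (a :: u) ⊆ P u)
    {u : List (Fin N)} (hu : 1 ≤ u.length) (w : List (Fin N))
    (hw : w.length + u.length ≤ 2 * ℓ) : P (w ++ u) ⊆ P u := by
  induction w with
  | nil => exact Finset.Subset.refl _
  | cons a w ih =>
    simp only [List.length_cons] at hw
    exact (hnest (w ++ u) (by simp; omega) (by simp; omega) a).trans (ih (by omega))

theorem Bset_disjoint_Aset
    (hnest : ∀ u : List (Fin N), 1 ≤ u.length → u.length ≤ 2 * ℓ - 1 →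
      ∀ a : Fin N, P (a :: u) ⊆ P u)
    {u : List (Fin N)} (hu : 1 ≤ u.length) (b : Bool) :
    Disjoint (Bset ℓ P u) (Aset (P u) b) := by
  rw [Finset.disjoint_left]
  intro i hi hi'
  simp only [Bset, Aset, mem_filter, mem_univ, true_and] at hi hi'
  obtain ⟨w, hw, x, hx, y, hy, hxy⟩ := hi
  have hsub := nested_append hnest hu w hw.le
  exact hxy ((hi' x (hsub hx)).trans (hi' y (hsub hy)).symm)

theorem Bset_eq_empty
    (hnest : ∀ u : List (Fin N), 1 ≤ u.length → u.length ≤ 2 * ℓ - 1 →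
      ∀ a : Fin N, P (a :: u) ⊆ P u)
    {u : List (Fin N)} (hu : 1 ≤ u.length) (hP : P u = ∅) : Bset ℓ P u = ∅ := by
  have h := Bset_disjoint_Aset hnest hu true
  exact Finset.eq_empty_of_forall_notMem fun i hi =>
    Finset.disjoint_left.1 h hi (by simp [Aset, hP])

theorem Bset_subset_biUnion {u : List (Fin N)} (hu : u.length < 2 * ℓ) :
    Bset ℓ P u ⊆ univ.biUnion fun a : Fin N => Bset ℓ P (a :: u) := by
  intro i hi
  simp only [Bset, mem_biUnion, mem_filter, mem_univ, true_and] at hi ⊢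
  obtain ⟨w, hw, hi⟩ := hi
  rcases List.eq_nil_or_concat w with rfl | ⟨w, a, rfl⟩
  · simp at hw; omega
  · refine ⟨a, w, ?_, ?_⟩
    · simp at hw ⊢; omega
    · simpa using hi

theorem card_Bset_add_card_Aset_le
    (hnest : ∀ u : List (Fin N), 1 ≤ u.length → u.length ≤ 2 * ℓ - 1 →
      ∀ a : Fin N, P (a :: u) ⊆ P u)
    {u : List (Fin N)} (hu : 1 ≤ u.length) (hu' : u.length ≤ 2 * ℓ - 1) (a : Fin N)
    (hne : (P (a :: u)).Nonempty) (b : Bool) :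
    (Bset ℓ P (a :: u)).card + (Aset (P u) b).card + (Aset (P (a :: u)) (!b)).card ≤ n := by
  have hlen : 1 ≤ (a :: u).length := by simp
  have hsub := Aset_anti (hnest u hu hu' a) b
  have h1 : Disjoint (Bset ℓ P (a :: u)) (Aset (P u) b) :=
    (Bset_disjoint_Aset hnest hlen b).mono_right hsub
  have h2 : Disjoint (Bset ℓ P (a :: u) ∪ Aset (P u) b) (Aset (P (a :: u)) (!b)) :=
    Finset.disjoint_union_left.2
      ⟨Bset_disjoint_Aset hnest hlen _, (Aset_disjoint hne b).mono_left hsub⟩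
  rw [← Finset.card_union_of_disjoint h1, ← Finset.card_union_of_disjoint h2]
  simpa using Finset.card_le_univ
    (Bset ℓ P (a :: u) ∪ Aset (P u) b ∪ Aset (P (a :: u)) (!b))

theorem card_Bset_leaf_le {s : ℕ} {K : ℝ} {u : List (Fin N)} (hu : u.length = 2 * ℓ)
    (hmid : ∀ x ∈ P u, MiddleLayers n s x)
    (hgood : (n : ℝ) / 2 - K ≤ ((Aset (P u) false).card : ℝ)) :
    ((Bset ℓ P u).card : ℝ) ≤ (P u).card * (s + K) := by
  have hsub : Bset ℓ P u ⊆
      (P u).biUnion fun x => (univ.filter fun i => x i = false) \ Aset (P u) false := by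
    intro i hi
    simp only [Bset, mem_filter, mem_univ, true_and] at hi
    obtain ⟨w, hw, x, hx, y, hy, hxy⟩ := hi
    obtain rfl : w = [] := List.length_eq_zero_iff.1 (by omega)
    simp only [List.nil_append] at hx hy
    simp only [Aset, mem_biUnion, mem_sdiff, mem_filter, mem_univ, true_and]
    cases hxi : x i
    · exact ⟨x, hx, hxi, fun h => hxy (by rw [h x hx, h y hy])⟩
    · cases hyi : y i
      · exact ⟨y, hy, hyi, fun h => hxy (by rw [h x hx, h y hy])⟩
      · exact absurd (hxi.trans hyi.symm) hxy
  have hcard : ((Bset ℓ P u).card : ℝ) ≤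
      ∑ x ∈ P u, (((univ.filter fun i => x i = false) \ Aset (P u) false).card : ℝ) := by
    exact_mod_cast (Finset.card_le_card hsub).trans Finset.card_biUnion_le
  refine hcard.trans ?_
  rw [← nsmul_eq_mul]
  refine Finset.sum_le_card_nsmul _ _ _ fun x hx => ?_
  have hA : Aset (P u) false ⊆ univ.filter fun i => x i = false := by
    intro i hi
    simp only [Aset, mem_filter, mem_univ, true_and] at hi ⊢
    exact hi x hx
  rw [Finset.cast_card_sdiff hA]
  have h1 : (((univ.filter fun i => x i = false).card : ℝ)) + hwt x = n := by
    exact_mod_cast card_filter_false x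
  have h2 : (n : ℝ) ≤ 2 * hwt x + 2 * s := by exact_mod_cast (hmid x hx).1
  linarith

end Tree

/-- Interpolating between a power bound in the small parameter `r` and a linear bound in the
large parameter `p`. -/
theorem le_mul_rpow_of_le_of_le {b C r p : ℝ} (m : ℕ) (hC : 0 ≤ C) (hr : 0 < r) (hp : 0 < p)
    (h1 : b ≤ C * r ^ ((1 : ℝ) + 1 / ((m + 1 : ℕ) : ℝ))) (h2 : b ≤ C * p) :
    b ≤ C * (r * p ^ ((1 : ℝ) / ((m + 1 + 1 : ℕ) : ℝ))) := by
  have hm : (0 : ℝ) < (m : ℝ) + 1 := by positivity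
  rcases le_total r (p ^ (((m : ℝ) + 1) / ((m : ℝ) + 1 + 1))) with h | h
  · refine h1.trans (mul_le_mul_of_nonneg_left ?_ hC)
    rw [Real.rpow_add hr, Real.rpow_one]
    refine mul_le_mul_of_nonneg_left ?_ hr.le
    have h3 := Real.rpow_le_rpow hr.le h (z := 1 / ((m : ℝ) + 1)) (by positivity)
    rw [← Real.rpow_mul hp.le] at h3
    have h4 : ((m : ℝ) + 1) / (m + 1 + 1) * (1 / (m + 1)) = 1 / (m + 1 + 1) := by
      field_simp
    rw [h4] at h3
    exact_mod_cast h3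
  · refine h2.trans (mul_le_mul_of_nonneg_left ?_ hC)
    calc p = p ^ (((m : ℝ) + 1) / ((m : ℝ) + 1 + 1)) * p ^ ((1 : ℝ) / ((m + 1 + 1 : ℕ) : ℝ)) := by
          rw [← Real.rpow_add hp]
          conv_lhs => rw [← Real.rpow_one p]
          congr 1
          push_cast
          field_simp
      _ ≤ _ := mul_le_mul_of_nonneg_right h (by positivity)

/-- with nesting (i), branching (ii) and goodness (iii), every node `u`
at level `1 ≤ k ≤ 2ℓ-1` satisfies
`|B_u| ≤ 4^{2ℓ-k} · 250 √n (log₂ n) · |P_u|^{1 + 1/(2ℓ-k+1)}`. -/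
theorem stmt9 (ℓ n s q : ℕ) (hℓ : 1 ≤ ℓ) (hn : 2 ≤ n) (hs : s * s = n) (hq : 1 ≤ q)
    (N : ℕ) (hN : N = 2 ^ s)
    (P : List (Fin N) → Finset (Fin n → Bool))
    (hmid : ∀ u : List (Fin N), 1 ≤ u.length → u.length ≤ 2 * ℓ →
      ∀ x ∈ P u, MiddleLayers n s x)
    (hnest : ∀ u : List (Fin N), 1 ≤ u.length → u.length ≤ 2 * ℓ - 1 →
      ∀ a : Fin N, P (a :: u) ⊆ P u)
    (hbr : ∀ u : List (Fin N), 1 ≤ u.length → u.length ≤ 2 * ℓ - 1 →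
      ∑ a : Fin N, (P (a :: u)).card ≤ 2 * (P u).card)
    (hbr0 : ∑ a : Fin N, (P [a]).card ≤ 2 * q)
    (hgood1 : ∀ u : List (Fin N), u.length % 2 = 1 → u.length ≤ 2 * ℓ →
      (P u).Nonempty →
      (n : ℝ) / 2 - 100 * s * Real.logb 2 n * (P u).card ≤ ((Aset (P u) true).card : ℝ))
    (hgood0 : ∀ u : List (Fin N), u.length % 2 = 0 → 1 ≤ u.length → u.length ≤ 2 * ℓ →
      (P u).Nonempty →
      (n : ℝ) / 2 - 100 * s * Real.logb 2 n * (P u).card ≤ ((Aset (P u) false).card : ℝ)) :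
    ∀ u : List (Fin N), 1 ≤ u.length → u.length ≤ 2 * ℓ - 1 →
      ((Bset ℓ P u).card : ℝ) ≤ (4 : ℝ) ^ (2 * ℓ - u.length) * (250 * s * Real.logb 2 n) *
        ((P u).card : ℝ) ^ ((1 : ℝ) + 1 / ((2 * ℓ - u.length + 1 : ℕ) : ℝ)) := by
  have hs1 : (1 : ℝ) ≤ s := by
    have : 1 ≤ s := by
      rcases Nat.eq_zero_or_pos s with rfl | h
      · omega
      · exact h
    exact_mod_cast this
  have hL : (1 : ℝ) ≤ Real.logb 2 n := by
    rw [Real.le_logb_iff_rpow_le (by norm_num) (by positivity)]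
    simpa using (show (2 : ℝ) ≤ n by exact_mod_cast hn)
  set M : ℝ := s * Real.logb 2 n with hM
  have hsM : (s : ℝ) ≤ M := le_mul_of_one_le_right (by linarith) hL
  have hM0 : 0 < M := by positivity
  have hmul : ∀ c : ℝ, c * s * Real.logb 2 n = c * M := fun c => by rw [hM, mul_assoc]
  simp only [hmul] at hgood1 hgood0 ⊢
  have key : ∀ (m : ℕ) (u : List (Fin N)), 1 ≤ u.length → u.length + m = 2 * ℓ →
      ((Bset ℓ P u).card : ℝ) ≤ (4 : ℝ) ^ m * (250 * M) *
        ((P u).card : ℝ) ^ ((1 : ℝ) + 1 / ((m + 1 : ℕ) : ℝ)) := by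
    intro m
    induction m with
    | zero =>
      intro u hu hum
      rcases (P u).eq_empty_or_nonempty with he | hne
      · rw [Bset_eq_empty hnest hu he, Finset.card_empty, Nat.cast_zero]
        positivity
      · have hleaf := card_Bset_leaf_le (ℓ := ℓ) (by omega) (hmid u hu (by omega))
          (hgood0 u (by omega) hu (by omega) hne)
        have hp : (1 : ℝ) ≤ (P u).card := by exact_mod_cast hne.card_pos
        refine hleaf.trans ?_
        have he : ((P u).card : ℝ) ^ ((1 : ℝ) + 1 / ((0 + 1 : ℕ) : ℝ)) = ((P u).card : ℝ) ^ 2 := by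
          rw [← Real.rpow_natCast]
          norm_num
        have hMp : M ≤ M * (P u).card := le_mul_of_one_le_right hM0.le hp
        rw [he]
        calc ((P u).card : ℝ) * (s + 100 * M * (P u).card)
            ≤ (P u).card * (250 * M * (P u).card) := by
              gcongr
              linarith
          _ = _ := by ring
    | succ m ih =>
      intro u hu hum
      rcases (P u).eq_empty_or_nonempty with he | hne
      · rw [Bset_eq_empty hnest hu he, Finset.card_empty, Nat.cast_zero]
        positivity
      have hp : (0 : ℝ) < (P u).card := by exact_mod_cast hne.card_pos
      have hchild : ∀ a : Fin N, ((Bset ℓ P (a :: u)).card : ℝ) ≤ (4 : ℝ) ^ m * (250 * M) *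
          ((P (a :: u)).card * ((P u).card : ℝ) ^ ((1 : ℝ) / ((m + 1 + 1 : ℕ) : ℝ))) := by
        intro a
        rcases (P (a :: u)).eq_empty_or_nonempty with he | hnea
        · rw [Bset_eq_empty hnest (by simp) he, Finset.card_empty, Nat.cast_zero]
          positivity
        refine le_mul_rpow_of_le_of_le m (by positivity) (by exact_mod_cast hnea.card_pos) hp
          (ih (a :: u) (by simp) (by simp; omega)) ?_
        have hle : ((P (a :: u)).card : ℝ) ≤ (P u).card := by
          exact_mod_cast Finset.card_le_card (hnest u hu (by omega) a)
        have hlin : ((Bset ℓ P (a :: u)).card : ℝ) ≤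
            100 * M * (P u).card + 100 * M * (P (a :: u)).card := by
          rcases Nat.mod_two_eq_zero_or_one u.length with hpar | hpar
          · have h0 := hgood0 u hpar hu (by omega) hne
            have h1 := hgood1 (a :: u) (by simp; omega) (by simp; omega) hnea
            have h2 : ((Bset ℓ P (a :: u)).card : ℝ) + (Aset (P u) false).card +
                (Aset (P (a :: u)) true).card ≤ n := by
              exact_mod_cast card_Bset_add_card_Aset_le hnest hu (by omega) a hnea false
            linarith
          · have h0 := hgood1 u hpar (by omega) hne
            have h1 := hgood0 (a :: u) (by simp; omega) (by simp) (by simp; omega) hnea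
            have h2 : ((Bset ℓ P (a :: u)).card : ℝ) + (Aset (P u) true).card +
                (Aset (P (a :: u)) false).card ≤ n := by
              exact_mod_cast card_Bset_add_card_Aset_le hnest hu (by omega) a hnea true
            linarith
        have h4 : (1 : ℝ) ≤ 4 ^ m := one_le_pow₀ (by norm_num)
        calc ((Bset ℓ P (a :: u)).card : ℝ) ≤ 1 * (250 * M) * (P u).card := by nlinarith
          _ ≤ _ := by gcongr
      have hsum : ((Bset ℓ P u).card : ℝ) ≤ ∑ a : Fin N, ((Bset ℓ P (a :: u)).card : ℝ) := by
        exact_mod_cast (Finset.card_le_card (Bset_subset_biUnion (by omega))).trans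
          Finset.card_biUnion_le
      have hbrR : ∑ a : Fin N, ((P (a :: u)).card : ℝ) ≤ 2 * (P u).card := by
        exact_mod_cast hbr u hu (by omega)
      refine (hsum.trans (Finset.sum_le_sum fun a _ => hchild a)).trans ?_
      rw [← Finset.mul_sum, ← Finset.sum_mul, Real.rpow_add hp, Real.rpow_one, pow_succ]
      set E : ℝ := ((P u).card : ℝ) ^ ((1 : ℝ) / ((m + 1 + 1 : ℕ) : ℝ))
      have hE : 0 ≤ E := by positivity
      calc (4 : ℝ) ^ m * (250 * M) * ((∑ a : Fin N, ((P (a :: u)).card : ℝ)) * E)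
          ≤ (4 : ℝ) ^ m * (250 * M) * (4 * (P u).card * E) := by
            gcongr
            linarith
        _ = _ := by ring
  intro u hu hu'
  exact key (2 * ℓ - u.length) u hu (by omega)
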